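/- arXiv:2110.15291 — 2 statements merged into one kernel-verified Lean document; each statement's English description precedes it below -/
import Mathlib

section
/- Let F be a forest with n vertices and m connected components. When the chromatic symmetric function X_F is expanded over the path basis {X_{P_λ}}, the sum of the coefficients over partitions of length k equals 1 if k = m and 0 otherwise. In other words, the tree polynomial of F is τ_F(x) = x^m. -/
open Polynomial

noncomputable section
open scoped Classical

/-- The weighted chromatic symmetric function of a (vertex-weighted) finite simple graph,
as a formal power series in the variables `x_0, x_1, x_2, …`: the coefficient of a monomial
`d` is the number of proper colourings `κ : V → ℕ` such that for each colour `i`, the total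
weight of vertices coloured `i` is `d i`. -/
def wcsf {V : Type} [Fintype V] (G : SimpleGraph V) (ω : V → ℕ) : MvPowerSeries ℕ ℚ :=
  fun d => (Nat.card {κ : V → ℕ // (∀ u v, G.Adj u v → κ u ≠ κ v) ∧
    ∀ i : ℕ, ∑ v ∈ Finset.univ.filter (fun v => κ v = i), ω v = d i} : ℚ)

/-- The (unweighted) chromatic symmetric function. -/
def csf {V : Type} [Fintype V] (G : SimpleGraph V) : MvPowerSeries ℕ ℚ :=
  wcsf G (fun _ => 1)

/-- `XP μ` is the chromatic symmetric function of the disjoint union of paths whose sizes are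
given by the multiset `μ` (the chromatic symmetric function is multiplicative over disjoint
unions). -/
def XP (μ : Multiset ℕ) : MvPowerSeries ℕ ℚ :=
  (μ.map (fun m => csf (SimpleGraph.pathGraph m))).prod

/-- The power-sum symmetric function `p_n = Σ_i x_i^n`. -/
def psum (n : ℕ) : MvPowerSeries ℕ ℚ :=
  fun d => if ∃ i, d = Finsupp.single i n then 1 else 0

/-- The power-sum symmetric function `p_μ`. -/
def pp (μ : Multiset ℕ) : MvPowerSeries ℕ ℚ := (μ.map psum).prod

/-- `P` is the chromatic polynomial of `G`: `P(k)` counts proper `k`-colourings for all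
positive integers `k`. -/
def IsChromaticPoly {V : Type} [Fintype V] (G : SimpleGraph V) (P : Polynomial ℚ) : Prop :=
  ∀ k : ℕ, 0 < k → P.eval (k : ℚ) =
    Nat.card {c : V → Fin k // ∀ u v, G.Adj u v → c u ≠ c v}

/-- The polynomial `Σ_λ a_λ x^{ℓ(λ)}` built from coefficients `a` indexed by partitions of
`n`; when `a` gives the path-basis coefficients of `X_G` this is the tree polynomial `τ_G`,
and when `a` gives the power-sum coefficients it is the chromatic polynomial. -/
def basisPoly (n : ℕ) (a : n.Partition → ℚ) : Polynomial ℚ :=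
  ∑ l : n.Partition, Polynomial.C (a l) * Polynomial.X ^ l.parts.card

/-- Setting `x_i = t` for `i < k` and `x_i = 0` for `i ≥ k`. -/
def principalSpecialization (k : ℕ) : MvPowerSeries ℕ ℚ →ₐ[ℚ] PowerSeries ℚ :=
  AlgHom.ofLinearMap
    { toFun := fun f => PowerSeries.mk fun N =>
        ∑ d ∈ (Finset.range k).finsuppAntidiag N, MvPowerSeries.coeff d f
      map_add' := fun f g => by ext; simp [Finset.sum_add_distrib]
      map_smul' := fun c f => by ext; simp [Finset.mul_sum] }
    (by
      ext N
      simp only [LinearMap.coe_mk, AddHom.coe_mk, PowerSeries.coeff_mk, MvPowerSeries.coeff_one,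
        PowerSeries.coeff_one, Finset.sum_ite_eq', Finset.mem_finsuppAntidiag]
      simp [eq_comm])
    (fun f g => by
      ext N
      simp only [LinearMap.coe_mk, AddHom.coe_mk, PowerSeries.coeff_mk, MvPowerSeries.coeff_mul,
        PowerSeries.coeff_mul, Finset.sum_mul_sum, ← Finset.sum_product']
      rw [Finset.sum_sigma', Finset.sum_sigma']
      refine Finset.sum_bij'
        (fun x _ => ⟨((Finset.range k).sum x.2.1, (Finset.range k).sum x.2.2), x.2⟩)
        (fun x _ => ⟨x.2.1 + x.2.2, x.2⟩) ?_ ?_ ?_ ?_ ?_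
      · rintro ⟨d, p, q⟩ h
        simp only [Finset.mem_sigma, Finset.mem_finsuppAntidiag, Finset.HasAntidiagonal.mem_antidiagonal,
          Finset.mem_product] at h ⊢
        obtain ⟨⟨h1, h2⟩, rfl⟩ := h
        refine ⟨by simpa [Finset.sum_add_distrib] using h1, ⟨trivial, ?_⟩, trivial, ?_⟩
        · exact (Finsupp.support_mono le_self_add).trans h2
        · exact (Finsupp.support_mono le_add_self).trans h2
      · rintro ⟨⟨i, j⟩, p, q⟩ h
        simp only [Finset.mem_sigma, Finset.mem_finsuppAntidiag, Finset.HasAntidiagonal.mem_antidiagonal,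
          Finset.mem_product] at h ⊢
        obtain ⟨h0, ⟨h1, h2⟩, h3, h4⟩ := h
        refine ⟨⟨by simpa [Finset.sum_add_distrib, h1, h3] using h0, ?_⟩, trivial⟩
        exact Finsupp.support_add.trans (Finset.union_subset h2 h4)
      · rintro ⟨d, p, q⟩ h
        simp only [Finset.mem_sigma, Finset.HasAntidiagonal.mem_antidiagonal] at h
        simp [h.2]
      · rintro ⟨⟨i, j⟩, p, q⟩ h
        simp only [Finset.mem_sigma, Finset.mem_finsuppAntidiag, Finset.mem_product] at h
        obtain ⟨-, ⟨rfl, -⟩, rfl, -⟩ := h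
        rfl
      · intros
        rfl)

lemma coeff_principalSpecialization (k N : ℕ) (f : MvPowerSeries ℕ ℚ) :
    PowerSeries.coeff N (principalSpecialization k f) =
      ∑ d ∈ (Finset.range k).finsuppAntidiag N, MvPowerSeries.coeff d f := by
  simp [principalSpecialization]

/-- The principal specialization of `X_G` at `k` variables is `χ_G(k) t^{|V|}`. -/
lemma principalSpecialization_csf {V : Type} [Fintype V] (G : SimpleGraph V) (k : ℕ) :
    principalSpecialization k (csf G) = PowerSeries.monomial (Fintype.card V)
      (Nat.card {c : V → Fin k // ∀ u v, G.Adj u v → c u ≠ c v} : ℚ) := by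
  ext N
  rw [coeff_principalSpecialization, PowerSeries.coeff_monomial]
  set K : Finset (V → ℕ) := (Fintype.piFinset fun _ : V => Finset.range k).filter
    fun κ => ∀ u v, G.Adj u v → κ u ≠ κ v with hK
  let content : (V → ℕ) → (ℕ →₀ ℕ) := fun κ => ∑ v, Finsupp.single (κ v) 1
  have content_apply (κ : V → ℕ) (i : ℕ) :
      content κ i = ∑ v ∈ Finset.univ.filter (fun v => κ v = i), 1 := by
    simp [content, Finsupp.finsetSum_apply, Finsupp.single_apply]
  have hcoeff (d) (hd : d ∈ (Finset.range k).finsuppAntidiag N) :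
      MvPowerSeries.coeff d (csf G) = ((K.filter fun κ => content κ = d).card : ℚ) := by
    rw [Finset.mem_finsuppAntidiag] at hd
    change (Nat.card _ : ℚ) = _
    rw [← Nat.card_eq_finsetCard]
    congr 1
    refine Nat.card_congr (Equiv.subtypeEquivRight fun κ => ?_)
    have hc : content κ = d ↔
        ∀ i, ∑ v ∈ Finset.univ.filter (fun v => κ v = i), 1 = d i := by
      simp only [Finsupp.ext_iff, content_apply]
    simp only [hK, Finset.mem_filter, Fintype.mem_piFinset, hc]
    refine ⟨fun h => ⟨⟨fun v => hd.2 ?_, h.1⟩, h.2⟩, fun h => ⟨h.1.2, h.2⟩⟩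
    rw [Finsupp.mem_support_iff, ← h.2]
    simp only [Finset.sum_const, smul_eq_mul, mul_one]
    exact Finset.card_ne_zero_of_mem (Finset.mem_filter.mpr ⟨Finset.mem_univ v, rfl⟩)
  have hmem (κ) (hκ : κ ∈ K) :
      content κ ∈ (Finset.range k).finsuppAntidiag (Fintype.card V) := by
    have hκ' : ∀ v, κ v ∈ Finset.range k := Fintype.mem_piFinset.mp (Finset.mem_filter.mp hκ).1
    rw [Finset.mem_finsuppAntidiag]
    constructor
    · simp only [content_apply]
      simpa using (Finset.card_eq_sum_card_fiberwise
        (s := (Finset.univ : Finset V)) (t := Finset.range k) (f := κ) fun v _ => hκ' v).symm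
    · intro i hi
      rw [Finsupp.mem_support_iff, content_apply] at hi
      obtain ⟨v, hv, -⟩ := Finset.exists_ne_zero_of_sum_ne_zero hi
      rw [← (Finset.mem_filter.mp hv).2]
      exact hκ' v
  rw [Finset.sum_congr rfl hcoeff]
  split_ifs with hN
  · subst hN
    rw [← Nat.cast_sum, ← Finset.card_eq_sum_card_fiberwise hmem, ← Nat.card_eq_finsetCard]
    congr 1
    refine Nat.card_congr
      { toFun := fun κ => ⟨fun v => ⟨κ.1 v, ?_⟩, fun u v h => ?_⟩
        invFun := fun c => ⟨fun v => c.1 v, ?_⟩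
        left_inv := fun κ => rfl
        right_inv := fun c => rfl }
    · exact Finset.mem_range.mp (Fintype.mem_piFinset.mp (Finset.mem_filter.mp κ.2).1 v)
    · simpa [Fin.ext_iff] using (Finset.mem_filter.mp κ.2).2 u v h
    · refine Finset.mem_filter.mpr ⟨Fintype.mem_piFinset.mpr fun v => by simp, fun u v h => ?_⟩
      simpa [Fin.ext_iff] using c.2 u v h
  · refine Finset.sum_eq_zero fun d hd => ?_
    rw [Nat.cast_eq_zero, Finset.card_eq_zero, Finset.filter_eq_empty_iff]
    rintro κ hκ rfl
    rw [Finset.mem_finsuppAntidiag] at hd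
    exact hN (hd.1.symm.trans (Finset.mem_finsuppAntidiag.mp (hmem κ hκ)).1)

section Forest

variable {V α : Type} [Fintype V] [AddCommGroup α] [Fintype α]

/-- The maps `V → α` whose differences along the edges of `G` lie in `S`. -/
def edgeLabellings (G : SimpleGraph V) (S : Finset α) : Finset (V → α) :=
  Finset.univ.filter fun κ => ∀ u v, G.Adj u v → κ u - κ v ∈ S

/-- Translating the labels on the component of `v` shows that, when `u` and `v` are not connected,
all values of the difference `κ u - κ v` are equally frequent. -/
lemma card_edgeLabellings_filter_eq {G : SimpleGraph V} (S : Finset α) {u v : V}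
    (huv : ¬ G.Reachable u v) (x y : α) :
    ((edgeLabellings G S).filter fun κ => κ u - κ v = x).card =
      ((edgeLabellings G S).filter fun κ => κ u - κ v = y).card := by
  have key (δ x y : α) (hδ : x + δ = y) (κ : V → α)
      (hκ : κ ∈ (edgeLabellings G S).filter fun κ => κ u - κ v = x) :
      (fun w => if G.Reachable u w then κ w + δ else κ w) ∈
        (edgeLabellings G S).filter fun κ => κ u - κ v = y := by
    simp only [edgeLabellings, Finset.mem_filter, Finset.mem_univ, true_and] at hκ ⊢
    refine ⟨fun a b hab => ?_, ?_⟩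
    · have hiff : G.Reachable u a ↔ G.Reachable u b :=
        ⟨fun h => h.trans hab.reachable, fun h => h.trans hab.symm.reachable⟩
      by_cases hb : G.Reachable u b
      · simpa [hiff, hb] using hκ.1 a b hab
      · simpa [hiff, hb] using hκ.1 a b hab
    · simp only [SimpleGraph.Reachable.refl, huv, if_true, if_false, ← hδ, ← hκ.2]
      abel
  refine Finset.card_bij' (fun κ _ w => if G.Reachable u w then κ w + (y - x) else κ w)
    (fun κ _ w => if G.Reachable u w then κ w + (x - y) else κ w)
    (key _ _ _ (by abel)) (key _ _ _ (by abel)) ?_ ?_ <;>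
  · intro κ _
    funext w
    dsimp only
    split_ifs <;> abel

lemma card_mul_card_edgeLabellings {G : SimpleGraph V} (S : Finset α) (hS : ∀ x ∈ S, -x ∈ S)
    {u v : V} (h : G.Adj u v) (hb : G.IsBridge s(u, v)) :
    Fintype.card α * (edgeLabellings G S).card =
      S.card * (edgeLabellings (G.deleteEdges {s(u, v)}) S).card := by
  rw [SimpleGraph.isBridge_iff] at hb
  set G' := G.deleteEdges {s(u, v)} with hG'
  have hG : edgeLabellings G S = (edgeLabellings G' S).filter fun κ => κ u - κ v ∈ S := by
    ext κ
    simp only [edgeLabellings, Finset.mem_filter, Finset.mem_univ, true_and, hG',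
      SimpleGraph.deleteEdges_adj, Set.mem_singleton_iff]
    refine ⟨fun hκ => ⟨fun a b hab => hκ a b hab.1, hκ u v h⟩, fun hκ a b hab => ?_⟩
    by_cases he : s(a, b) = s(u, v)
    · rcases Sym2.eq_iff.mp he with ⟨rfl, rfl⟩ | ⟨rfl, rfl⟩
      · exact hκ.2
      · simpa using hS _ hκ.2
    · exact hκ.1 a b ⟨hab, he⟩
  have hfib (T : Finset α) : ((edgeLabellings G' S).filter fun κ => κ u - κ v ∈ T).card =
      T.card * ((edgeLabellings G' S).filter fun κ => κ u - κ v = 0).card := by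
    rw [Finset.card_eq_sum_card_fiberwise
      (s := (edgeLabellings G' S).filter fun κ => κ u - κ v ∈ T) (t := T)
      (f := fun κ : V → α => κ u - κ v)
      (fun κ hκ => (Finset.mem_filter.mp hκ).2), ← smul_eq_mul, ← Finset.sum_const]
    refine Finset.sum_congr rfl fun x hx => ?_
    rw [← card_edgeLabellings_filter_eq S hb x 0, Finset.filter_filter]
    congr 1
    refine Finset.filter_congr fun κ _ => ⟨fun hκ => hκ.2, fun hκ => ⟨hκ ▸ hx, hκ⟩⟩
  have huniv := hfib Finset.univ
  simp only [Finset.mem_univ, Finset.filter_true, Finset.card_univ] at huniv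
  rw [hG, hfib, huniv]
  ring

lemma card_edgeLabellings_of_isAcyclic (S : Finset α) (hS : ∀ x ∈ S, -x ∈ S)
    {G : SimpleGraph V} (hG : G.IsAcyclic) :
    Fintype.card α ^ G.edgeFinset.card * (edgeLabellings G S).card =
      Fintype.card α ^ Fintype.card V * S.card ^ G.edgeFinset.card := by
  induction hq : G.edgeFinset.card generalizing G with
  | zero =>
    rw [Finset.card_eq_zero, SimpleGraph.edgeFinset_eq_empty] at hq
    subst hq
    simp [edgeLabellings]
  | succ q ih =>
    obtain ⟨e, he⟩ := Finset.card_pos.mp (hq.symm ▸ q.succ_pos : 0 < G.edgeFinset.card)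
    induction e with | h u v => ?_
    have hadj : G.Adj u v := by simpa using he
    have hcard : (G.deleteEdges {s(u, v)}).edgeFinset.card = q := by
      have : (G.deleteEdges {s(u, v)}).edgeFinset = G.edgeFinset.erase s(u, v) := by
        ext e
        rw [SimpleGraph.mem_edgeFinset, SimpleGraph.edgeSet_deleteEdges, Finset.mem_erase,
          SimpleGraph.mem_edgeFinset, Set.mem_sdiff, Set.mem_singleton_iff, and_comm]
      rw [this, Finset.card_erase_of_mem he, hq, Nat.add_sub_cancel]
    have := ih (hG.anti (SimpleGraph.deleteEdges_le _)) (by convert hcard)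
    have hb := SimpleGraph.isAcyclic_iff_forall_adj_isBridge.mp hG hadj
    rw [pow_succ, mul_assoc, card_mul_card_edgeLabellings S hS hadj hb, mul_left_comm, this]
    ring

lemma card_edgeLabellings_zero (G : SimpleGraph V) :
    (edgeLabellings G {(0 : α)}).card = Fintype.card α ^ Nat.card G.ConnectedComponent := by
  rw [← Nat.card_eq_finsetCard, ← Nat.card_eq_fintype_card, ← Nat.card_fun]
  refine Nat.card_congr
    { toFun := fun κ => SimpleGraph.ConnectedComponent.lift κ.1 fun u v p _ => ?_
      invFun := fun c => ⟨fun v => c (G.connectedComponentMk v), ?_⟩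
      left_inv := fun κ => rfl
      right_inv := fun c => funext fun C => by
        induction C using SimpleGraph.ConnectedComponent.ind
        rfl }
  · have hκ := (Finset.mem_filter.mp κ.2).2
    induction p with
    | nil => rfl
    | cons h p ih =>
      rename_i hp
      exact (sub_eq_zero.mp (Finset.mem_singleton.mp (hκ _ _ h))).trans (ih hp.of_cons)
  · simp only [edgeLabellings, Finset.mem_filter, Finset.mem_univ, true_and,
      Finset.mem_singleton, sub_eq_zero]
    intro u v h
    rw [SimpleGraph.ConnectedComponent.eq.mpr h.reachable]

lemma SimpleGraph.IsAcyclic.card_edgeFinset_add_card_connectedComponent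
    {G : SimpleGraph V} (hG : G.IsAcyclic) :
    G.edgeFinset.card + Nat.card G.ConnectedComponent = Fintype.card V := by
  have h := card_edgeLabellings_of_isAcyclic {(0 : ZMod 2)} (by simp) hG
  rw [card_edgeLabellings_zero, ← pow_add, Finset.card_singleton, one_pow, mul_one, ZMod.card] at h
  exact Nat.pow_right_injective le_rfl h

/-- The chromatic polynomial of a forest, at `j + 1` colours. -/
lemma SimpleGraph.IsAcyclic.card_proper_colorings {G : SimpleGraph V} (hG : G.IsAcyclic)
    {j : ℕ} (hj : 0 < j) :
    (Nat.card {c : V → Fin (j + 1) // ∀ u v, G.Adj u v → c u ≠ c v} : ℚ) =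
      ((j + 1) / j) ^ Nat.card G.ConnectedComponent * j ^ Fintype.card V := by
  have h := card_edgeLabellings_of_isAcyclic (Finset.univ.erase (0 : Fin (j + 1))) (by simp) hG
  have hK : Nat.card {c : V → Fin (j + 1) // ∀ u v, G.Adj u v → c u ≠ c v} =
      (edgeLabellings G (Finset.univ.erase (0 : Fin (j + 1)))).card := by
    rw [← Nat.card_eq_finsetCard]
    refine Nat.card_congr (Equiv.subtypeEquivRight fun κ => ?_)
    simp [edgeLabellings, sub_eq_zero]
  have hj' : (j : ℚ) ≠ 0 := by positivity
  have hj'' : (j : ℚ) + 1 ≠ 0 := by positivity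
  rw [← hK, Fintype.card_fin, Finset.card_erase_of_mem (Finset.mem_univ _), Finset.card_univ,
    Fintype.card_fin, Nat.add_sub_cancel,
    ← hG.card_edgeFinset_add_card_connectedComponent] at h
  rw [← hG.card_edgeFinset_add_card_connectedComponent]
  have h' := congrArg (Nat.cast : ℕ → ℚ) h
  push_cast at h'
  refine mul_left_cancel₀ (pow_ne_zero G.edgeFinset.card hj'') (h'.trans ?_)
  rw [div_pow, pow_add, pow_add]
  field_simp

end Forest

lemma SimpleGraph.isAcyclic_pathGraph (p : ℕ) : (SimpleGraph.pathGraph p).IsAcyclic := by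
  rw [SimpleGraph.isAcyclic_iff_forall_adj_isBridge]
  have key (u v : Fin p) (h : u.val + 1 = v.val) :
      (SimpleGraph.pathGraph p).IsBridge s(u, v) := by
    rw [SimpleGraph.isBridge_iff]
    rintro ⟨w⟩
    have hw (a b : Fin p) (w : ((SimpleGraph.pathGraph p).deleteEdges {s(u, v)}).Walk a b)
        (ha : a ≤ u) : b ≤ u := by
      induction w with
      | nil => exact ha
      | @cons a c b hac _ ih =>
        refine ih ?_
        rw [SimpleGraph.deleteEdges_adj, SimpleGraph.pathGraph_adj] at hac
        by_contra hc
        refine hac.2 ?_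
        have h1 : a = u := by omega
        have h2 : c = v := by omega
        simp [h1, h2]
    have := hw u v w le_rfl
    omega
  intro u v h
  rcases SimpleGraph.pathGraph_adj.mp h with h | h
  · exact key u v h
  · exact Sym2.eq_swap ▸ key v u h

lemma card_proper_colorings_pathGraph {p j : ℕ} (hp : 0 < p) (hj : 0 < j) :
    (Nat.card {c : Fin p → Fin (j + 1) //
      ∀ u v, (SimpleGraph.pathGraph p).Adj u v → c u ≠ c v} : ℚ) = (j + 1) / j * j ^ p := by
  have hcc : Nat.card (SimpleGraph.pathGraph p).ConnectedComponent = 1 := by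
    obtain ⟨q, rfl⟩ := Nat.exists_eq_succ_of_ne_zero hp.ne'
    have hconn := SimpleGraph.pathGraph_connected q
    have := hconn.preconnected.subsingleton_connectedComponent
    exact Nat.card_eq_one_iff_unique.mpr
      ⟨this, ⟨(SimpleGraph.pathGraph (q + 1)).connectedComponentMk 0⟩⟩
  rw [(SimpleGraph.isAcyclic_pathGraph p).card_proper_colorings hj, hcc, pow_one,
    Fintype.card_fin]

lemma principalSpecialization_XP {μ : Multiset ℕ} (hμ : ∀ p ∈ μ, 0 < p) {j : ℕ} (hj : 0 < j) :
    principalSpecialization (j + 1) (XP μ) =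
      PowerSeries.monomial μ.sum ((((j : ℚ) + 1) / j) ^ μ.card * (j : ℚ) ^ μ.sum) := by
  induction μ using Multiset.induction with
  | empty => simp [XP]
  | cons p μ ih =>
    have hmul : XP (p ::ₘ μ) = csf (SimpleGraph.pathGraph p) * XP μ := by simp [XP]
    rw [hmul, map_mul, ih fun q hq => hμ q (Multiset.mem_cons_of_mem hq),
      principalSpecialization_csf,
      card_proper_colorings_pathGraph (hμ p (Multiset.mem_cons_self p μ)) hj,
      PowerSeries.monomial_mul_monomial, Fintype.card_fin, Multiset.sum_cons,
      Multiset.card_cons]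
    congr 1
    ring

/-- if `F` is a forest with `n` vertices and `m` connected components, and
`X_F = Σ_{λ ⊢ n} a_λ X_{P_λ}` is the path-basis expansion of its chromatic symmetric
function, then the tree polynomial of `F` is `τ_F(x) = Σ_λ a_λ x^{ℓ(λ)} = x^m`. -/
theorem stmt_7 {V : Type} [Fintype V] (F : SimpleGraph V) (hF : F.IsAcyclic)
    (n m : ℕ) (hn : Fintype.card V = n) (hm : Nat.card F.ConnectedComponent = m)
    (a : n.Partition → ℚ)
    (ha : csf F = ∑ l : n.Partition, a l • XP l.parts) :
    basisPoly n a = Polynomial.X ^ m := by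
  subst hn hm
  have heval {j : ℕ} (hj : 0 < j) : (basisPoly _ a).eval (((j : ℚ) + 1) / j) =
      (Polynomial.X ^ Nat.card F.ConnectedComponent : Polynomial ℚ).eval (((j : ℚ) + 1) / j) := by
    have h := congrArg (fun f => PowerSeries.coeff (Fintype.card V)
      (principalSpecialization (j + 1) f)) ha
    have hXP (l : (Fintype.card V).Partition) :
        PowerSeries.coeff (Fintype.card V) (principalSpecialization (j + 1) (XP l.parts)) =
          (((j : ℚ) + 1) / j) ^ l.parts.card * (j : ℚ) ^ Fintype.card V := by
      rw [principalSpecialization_XP (fun p hp => l.parts_pos hp) hj, l.parts_sum,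
        PowerSeries.coeff_monomial_same]
    simp only [map_sum, map_smul, hXP, principalSpecialization_csf,
      PowerSeries.coeff_monomial_same, hF.card_proper_colorings hj, smul_eq_mul,
      ← mul_assoc, ← Finset.sum_mul] at h
    have hj' : (j : ℚ) ^ Fintype.card V ≠ 0 := by positivity
    simpa [basisPoly, Polynomial.eval_finsetSum] using (mul_right_cancel₀ hj' h).symm
  refine Polynomial.eq_of_infinite_eval_eq _ _ (Set.Infinite.mono ?_
    (Set.infinite_range_of_injective
      (f := fun i : ℕ => (((i + 1 : ℕ) : ℚ) + 1) / ((i + 1 : ℕ) : ℚ)) ?_))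
  · rintro _ ⟨i, rfl⟩
    exact heval i.succ_pos
  · intro i i' h
    have h1 : ((i + 1 : ℕ) : ℚ) ≠ 0 := by positivity
    have h2 : ((i' + 1 : ℕ) : ℚ) ≠ 0 := by positivity
    dsimp only at h
    rw [div_eq_div_iff h1 h2] at h
    push_cast at h
    have : (i : ℚ) = i' := by linarith
    exact_mod_cast this
end
end

section
/- Deletion-contraction for the tree polynomial: for an unweighted graph G and edge e, τ_G = τ_{G∖e} − (x−1)τ_{G/e}. -/
open Polynomial

noncomputable section
open scoped Classical

/-- The simple contraction `G/e` of an edge `e = uv`: vertices other than `v`, with `u`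
absorbing all neighbours of `v` (loops and multi-edges discarded). -/
def contractEdge {V : Type} (G : SimpleGraph V) (u v : V) : SimpleGraph {w : V // w ≠ v} :=
  SimpleGraph.fromRel (fun a b => G.Adj a.1 b.1 ∨ (a.1 = u ∧ G.Adj v b.1))

/-- The specialization `x_i ↦ X` for `i < k` and `x_i ↦ 0` for `i ≥ k`. -/
def specialize (k : ℕ) : MvPowerSeries ℕ ℚ →ₐ[ℚ] PowerSeries ℚ :=
  AlgHom.ofLinearMap
    { toFun := fun f => PowerSeries.mk fun m =>
        ∑ d ∈ (Finset.range k).finsuppAntidiag m, MvPowerSeries.coeff d f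
      map_add' := fun f g => by
        ext m
        simp [Finset.sum_add_distrib]
      map_smul' := fun r f => by
        ext m
        simp [Finset.mul_sum] }
    (by
      ext m
      simp only [LinearMap.coe_mk, AddHom.coe_mk, PowerSeries.coeff_mk, MvPowerSeries.coeff_one,
        PowerSeries.coeff_one, Finset.sum_ite_eq', Finset.mem_finsuppAntidiag]
      simp [eq_comm])
    (fun f g => by
      ext m
      simp only [LinearMap.coe_mk, AddHom.coe_mk, PowerSeries.coeff_mk, PowerSeries.coeff_mul,
        MvPowerSeries.coeff_mul, Finset.sum_mul_sum, ← Finset.sum_product']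
      rw [Finset.sum_sigma', Finset.sum_sigma']
      refine Finset.sum_bij'
        (fun x _ => ⟨((Finset.range k).sum x.2.1, (Finset.range k).sum x.2.2), x.2⟩)
        (fun x _ => ⟨x.2.1 + x.2.2, x.2⟩) ?_ ?_ ?_ ?_ ?_
      · rintro ⟨d, p, q⟩ h
        simp only [Finset.mem_sigma, Finset.mem_finsuppAntidiag,
          Finset.HasAntidiagonal.mem_antidiagonal] at h
        obtain ⟨⟨rfl, hs⟩, rfl⟩ := h
        simp only [Finset.mem_sigma, Finset.HasAntidiagonal.mem_antidiagonal, Finset.mem_product,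
          Finset.mem_finsuppAntidiag, true_and]
        refine ⟨by simp [Finset.sum_add_distrib], fun i hi => hs ?_, fun i hi => hs ?_⟩ <;>
          simp_all
      · rintro ⟨⟨i, j⟩, p, q⟩ h
        simp only [Finset.mem_sigma, Finset.HasAntidiagonal.mem_antidiagonal, Finset.mem_product,
          Finset.mem_finsuppAntidiag] at h
        obtain ⟨rfl, ⟨rfl, hp⟩, rfl, hq⟩ := h
        simp only [Finset.mem_sigma, Finset.HasAntidiagonal.mem_antidiagonal,
          Finset.mem_finsuppAntidiag, and_true]
        exact ⟨by simp [Finset.sum_add_distrib],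
          Finsupp.support_add.trans (Finset.union_subset hp hq)⟩
      · rintro ⟨d, p, q⟩ h
        simp only [Finset.mem_sigma, Finset.HasAntidiagonal.mem_antidiagonal] at h
        obtain ⟨-, rfl⟩ := h
        rfl
      · rintro ⟨⟨i, j⟩, p, q⟩ h
        simp only [Finset.mem_sigma, Finset.HasAntidiagonal.mem_antidiagonal, Finset.mem_product,
          Finset.mem_finsuppAntidiag] at h
        obtain ⟨rfl, ⟨rfl, hp⟩, rfl, hq⟩ := h
        rfl
      · intros
        rfl)

theorem coeff_specialize (k m : ℕ) (f : MvPowerSeries ℕ ℚ) :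
    PowerSeries.coeff m (specialize k f) =
      ∑ d ∈ (Finset.range k).finsuppAntidiag m, MvPowerSeries.coeff d f :=
  PowerSeries.coeff_mk m fun m =>
    ∑ d ∈ (Finset.range k).finsuppAntidiag m, MvPowerSeries.coeff d f

/-- The proper colourings of `G` with colours `0, …, k - 1`. -/
def properColourings {V : Type} [Fintype V] (G : SimpleGraph V) (k : ℕ) : Finset (V → ℕ) :=
  (Fintype.piFinset fun _ => Finset.range k).filter fun κ => ∀ u v, G.Adj u v → κ u ≠ κ v

theorem mem_properColourings {V : Type} [Fintype V] {G : SimpleGraph V} {k : ℕ} {κ : V → ℕ} :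
    κ ∈ properColourings G k ↔ (∀ v, κ v < k) ∧ ∀ u v, G.Adj u v → κ u ≠ κ v := by
  simp [properColourings]

/-- The number of vertices of each colour. -/
def colourContent {V : Type} [Fintype V] (κ : V → ℕ) : ℕ →₀ ℕ :=
  ∑ v, Finsupp.single (κ v) 1

theorem colourContent_apply {V : Type} [Fintype V] (κ : V → ℕ) (i : ℕ) :
    colourContent κ i = ∑ _v ∈ Finset.univ.filter (fun v => κ v = i), 1 := by
  simp [colourContent, Finsupp.finsetSum_apply, Finsupp.single_apply]

theorem colourContent_apply_self_ne_zero {V : Type} [Fintype V] (κ : V → ℕ) (v : V) :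
    colourContent κ (κ v) ≠ 0 := by
  rw [colourContent_apply, ← Finset.card_eq_sum_ones]
  exact Finset.card_ne_zero_of_mem (a := v) (by simp)

theorem colourContent_support_subset {V : Type} [Fintype V] {κ : V → ℕ} {s : Finset ℕ} :
    (colourContent κ).support ⊆ s ↔ ∀ v, κ v ∈ s := by
  refine ⟨fun h v => h (by simpa using colourContent_apply_self_ne_zero κ v), fun h i hi => ?_⟩
  rw [Finsupp.mem_support_iff, colourContent_apply, ← Finset.card_eq_sum_ones] at hi
  obtain ⟨v, hv⟩ := Finset.card_ne_zero.mp hi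
  simp only [Finset.mem_filter] at hv
  exact hv.2 ▸ h v

theorem sum_colourContent {V : Type} [Fintype V] {κ : V → ℕ} {s : Finset ℕ}
    (h : ∀ v, κ v ∈ s) : s.sum (colourContent κ) = Fintype.card V := by
  simp only [colourContent_apply, ← Finset.card_eq_sum_ones]
  exact (Finset.card_eq_sum_card_fiberwise fun v _ => h v).symm

theorem coeff_csf {V : Type} [Fintype V] (G : SimpleGraph V) {k : ℕ} {d : ℕ →₀ ℕ}
    (hd : d.support ⊆ Finset.range k) :
    MvPowerSeries.coeff d (csf G) =
      ((properColourings G k).filter fun κ => colourContent κ = d).card := by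
  change (Nat.card _ : ℚ) = _
  rw [← Nat.card_eq_finsetCard]
  congr 1
  refine Nat.card_congr (Equiv.subtypeEquivRight fun κ => ?_)
  have hcontent : (∀ i, ∑ _v ∈ Finset.univ.filter (fun v => κ v = i), 1 = d i) ↔
      colourContent κ = d := by
    simp only [Finsupp.ext_iff, colourContent_apply]
  rw [hcontent, Finset.mem_filter, mem_properColourings, and_assoc]
  refine ⟨fun h => ⟨fun v => ?_, h⟩, fun h => h.2⟩
  rw [← h.2] at hd
  simpa using colourContent_support_subset.mp hd v

theorem specialize_csf {V : Type} [Fintype V] (G : SimpleGraph V) (k : ℕ) :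
    specialize k (csf G) =
      PowerSeries.monomial (Fintype.card V) ((properColourings G k).card : ℚ) := by
  ext m
  rw [coeff_specialize, PowerSeries.coeff_monomial,
    Finset.sum_congr rfl fun d hd => coeff_csf G (Finset.mem_finsuppAntidiag.mp hd).2,
    ← Nat.cast_sum]
  split_ifs with hm
  · subst hm
    rw [← Finset.card_eq_sum_card_fiberwise]
    intro κ hκ
    have h : ∀ v, κ v ∈ Finset.range k := by
      simpa using (mem_properColourings.mp hκ).1
    simp only [Finset.mem_coe, Finset.mem_finsuppAntidiag]
    exact ⟨sum_colourContent h, colourContent_support_subset.mpr h⟩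
  · rw [Nat.cast_eq_zero, Finset.sum_eq_zero]
    intro d hd
    rw [Finset.card_eq_zero, Finset.filter_eq_empty_iff]
    rintro κ hκ rfl
    refine hm ((Finset.mem_finsuppAntidiag.mp hd).1.symm.trans (sum_colourContent ?_))
    simpa using (mem_properColourings.mp hκ).1

theorem card_properColourings_pathGraph (m k : ℕ) :
    (properColourings (SimpleGraph.pathGraph (m + 1)) k).card = k * (k - 1) ^ m := by
  induction m with
  | zero =>
    have : properColourings (SimpleGraph.pathGraph (0 + 1)) k =
        Fintype.piFinset fun _ => Finset.range k := by
      ext κ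
      rw [mem_properColourings, and_iff_left fun u v h =>
        (h.ne (Subsingleton.elim (α := Fin 1) u v)).elim]
      simp
    simp [this]
  | succ m ih =>
    have key : (properColourings (SimpleGraph.pathGraph (m + 1 + 1)) k).card =
        ((properColourings (SimpleGraph.pathGraph (m + 1)) k).sigma
          fun f => (Finset.range k).erase (f 0)).card := by
      refine Finset.card_nbij' (fun f => ⟨Fin.tail f, f 0⟩)
        (fun x => Fin.cons (α := fun _ => ℕ) x.2 x.1) ?_ ?_ ?_ ?_
      · intro f hf
        simp only [Finset.mem_coe, Finset.mem_sigma, mem_properColourings, Finset.mem_erase,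
          Finset.mem_range, SimpleGraph.pathGraph_adj] at hf ⊢
        refine ⟨⟨fun i => hf.1 _, fun i j h => hf.2 _ _ ?_⟩, hf.2 _ _ (by simp), hf.1 0⟩
        simpa using h
      · rintro ⟨f, c⟩ hf
        simp only [Finset.mem_coe, Finset.mem_sigma, mem_properColourings, Finset.mem_erase,
          Finset.mem_range, SimpleGraph.pathGraph_adj] at hf ⊢
        obtain ⟨⟨hf, hp⟩, hne, hc⟩ := hf
        refine ⟨Fin.cases (by simpa) (by simpa), fun i j => ?_⟩
        refine Fin.cases ?_ (fun i => ?_) i <;> refine Fin.cases ?_ (fun j => ?_) j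
        · simp
        · intro h
          have : j = 0 := by ext; simpa using h
          subst this
          simpa using hne
        · intro h
          have : i = 0 := by ext; simpa using h
          subst this
          simpa using hne.symm
        · intro h
          simpa using hp i j (by simpa using h)
      · intro f _
        exact Fin.cons_self_tail f
      · rintro ⟨f, c⟩ _
        simp
    rw [key, Finset.card_sigma, Finset.sum_const_nat (m := k - 1), ih, pow_succ, mul_assoc]
    intro f hf
    rw [Finset.card_erase_of_mem (by simpa using (mem_properColourings.mp hf).1 0),
      Finset.card_range]

theorem specialize_XP (k : ℕ) (hk : 2 ≤ k) (μ : Multiset ℕ) (hμ : ∀ m ∈ μ, 0 < m) :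
    specialize k (XP μ) = PowerSeries.monomial μ.sum
      (((k : ℚ) - 1) ^ μ.sum * ((k : ℚ) / (k - 1)) ^ μ.card) := by
  have hk' : (k : ℚ) - 1 ≠ 0 := by
    have : (2 : ℚ) ≤ k := by exact_mod_cast hk
    linarith
  induction μ using Multiset.induction_on with
  | empty => simp [XP]
  | cons m μ ih =>
    obtain ⟨m, rfl⟩ := Nat.exists_eq_succ_of_ne_zero (hμ m (by simp)).ne'
    have hXP : XP (m.succ ::ₘ μ) = csf (SimpleGraph.pathGraph (m + 1)) * XP μ := by simp [XP]
    rw [hXP, map_mul, ih fun i hi => hμ i (Multiset.mem_cons_of_mem hi), specialize_csf,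
      card_properColourings_pathGraph, PowerSeries.monomial_mul_monomial, Fintype.card_fin,
      Multiset.sum_cons, Multiset.card_cons]
    congr 1
    rw [Nat.cast_mul, Nat.cast_pow, Nat.cast_sub (by omega), Nat.cast_one]
    calc (k : ℚ) * (k - 1) ^ m * ((k - 1) ^ μ.sum * (k / (k - 1)) ^ μ.card)
        = (k / (k - 1)) * (k - 1) * (k - 1) ^ m *
            ((k - 1) ^ μ.sum * (k / (k - 1)) ^ μ.card) := by rw [div_mul_cancel₀ _ hk']
      _ = _ := by rw [Nat.succ_eq_add_one]; ring

theorem card_properColourings_eq_eval_basisPoly {V : Type} [Fintype V] (G : SimpleGraph V)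
    {n : ℕ} (hn : Fintype.card V = n) (a : n.Partition → ℚ)
    (ha : csf G = ∑ l : n.Partition, a l • XP l.parts) {k : ℕ} (hk : 2 ≤ k) :
    ((properColourings G k).card : ℚ) =
      ((k : ℚ) - 1) ^ n * (basisPoly n a).eval ((k : ℚ) / (k - 1)) := by
  have h := congrArg (fun f => PowerSeries.coeff n (specialize k f)) ha
  simp only [specialize_csf, hn, PowerSeries.coeff_monomial_same, map_sum, map_smul] at h
  rw [h, basisPoly, eval_finsetSum, Finset.mul_sum]
  refine Finset.sum_congr rfl fun l _ => ?_
  rw [specialize_XP k hk l.parts fun m hm => l.parts_pos hm, l.parts_sum,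
    PowerSeries.coeff_monomial_same]
  simp only [smul_eq_mul, eval_mul, eval_C, eval_pow, eval_X]
  ring

theorem card_properColourings_deleteEdges {V : Type} [Fintype V] (G : SimpleGraph V) {u v : V}
    (huv : G.Adj u v) (k : ℕ) :
    (properColourings (G.deleteEdges {s(u, v)}) k).card =
      (properColourings G k).card + (properColourings (contractEdge G u v) k).card := by
  rw [← Finset.card_filter_add_card_filter_not (fun κ : V → ℕ => κ u ≠ κ v)]
  congr 1
  · congr 1
    ext κ
    simp only [Finset.mem_filter, mem_properColourings, SimpleGraph.deleteEdges_adj,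
      Set.mem_singleton_iff, and_assoc]
    refine and_congr_right fun _ => ⟨fun ⟨h, hne⟩ x y hxy => ?_, fun h =>
      ⟨fun x y hxy => h x y hxy.1, h u v huv⟩⟩
    by_cases he : s(x, y) = s(u, v)
    · rcases Sym2.eq_iff.mp he with ⟨rfl, rfl⟩ | ⟨rfl, rfl⟩
      exacts [hne, hne.symm]
    · exact h x y ⟨hxy, he⟩
  · refine Finset.card_nbij' (fun κ w => κ w.1)
      (fun κ w => if h : w = v then κ ⟨u, huv.ne⟩ else κ ⟨w, h⟩) ?_ ?_ ?_ ?_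
    · intro κ hκ
      simp only [Finset.mem_coe, Finset.mem_filter, mem_properColourings, not_not,
        SimpleGraph.deleteEdges_adj, Set.mem_singleton_iff, contractEdge,
        SimpleGraph.fromRel_adj] at hκ ⊢
      obtain ⟨⟨hlt, hp⟩, he⟩ := hκ
      have hG : ∀ x y : V, x ≠ v → y ≠ v → G.Adj x y → κ x ≠ κ y := fun x y hx hy h =>
        hp x y ⟨h, fun h' => by
          rcases Sym2.eq_iff.mp h' with ⟨rfl, rfl⟩ | ⟨rfl, rfl⟩ <;> simp_all⟩
      have hv : ∀ y : V, y ≠ u → G.Adj v y → κ u ≠ κ y := fun y hy h => he ▸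
        hp v y ⟨h, fun h' => by
          rcases Sym2.eq_iff.mp h' with ⟨h₁, -⟩ | ⟨-, h₁⟩ <;> simp_all⟩
      refine ⟨fun w => hlt _, ?_⟩
      rintro ⟨x, hx⟩ ⟨y, hy⟩ ⟨hne, (h | ⟨rfl, h⟩) | (h | ⟨rfl, h⟩)⟩
      · exact hG x y hx hy h
      · exact hv y (fun h => hne (by simp [h])) h
      · exact (hG y x hy hx h).symm
      · exact (hv x (fun h => hne (by simp [h])) h).symm
    · intro κ hκ
      simp only [Finset.mem_coe, Finset.mem_filter, mem_properColourings, not_not,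
        SimpleGraph.deleteEdges_adj, Set.mem_singleton_iff, contractEdge,
        SimpleGraph.fromRel_adj] at hκ ⊢
      obtain ⟨hlt, hp⟩ := hκ
      have hv : ∀ y (hy : y ≠ v), G.Adj v y → s(v, y) ≠ s(u, v) →
          κ ⟨u, huv.ne⟩ ≠ κ ⟨y, hy⟩ := fun y hy h hs =>
        hp _ _ ⟨fun h' => hs (by rw [← Subtype.mk.inj h', Sym2.eq_swap]),
          Or.inl (Or.inr ⟨rfl, h⟩)⟩
      refine ⟨⟨fun w => by split_ifs <;> exact hlt _, fun x y ⟨h, hs⟩ => ?_⟩, by simp [huv.ne]⟩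
      by_cases hx : x = v <;> by_cases hy : y = v
      · subst hx hy
        exact (h.ne rfl).elim
      · subst hx
        simpa [hy] using hv y hy h hs
      · subst hy
        simpa [hx] using (hv x hx h.symm (by rwa [Sym2.eq_swap])).symm
      · simpa [hx, hy] using hp ⟨x, hx⟩ ⟨y, hy⟩
          ⟨fun h' => h.ne (Subtype.mk.inj h'), Or.inl (Or.inl h)⟩
    · intro κ hκ
      simp only [Finset.mem_coe, Finset.mem_filter, not_not] at hκ
      ext w
      by_cases hw : w = v
      · simp [hw, hκ.2]
      · simp [hw]
    · intro κ _
      ext ⟨w, hw⟩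
      simp [hw]

/-- deletion–contraction for the tree polynomial: for an unweighted graph
`G` and an edge `e = uv`, `τ_G = τ_{G∖e} − (x−1) τ_{G/e}`, where each tree polynomial comes
from the path-basis expansion of the corresponding chromatic symmetric function. -/
theorem stmt_16 {V : Type} [Fintype V] (G : SimpleGraph V) (u v : V) (huv : G.Adj u v)
    (n : ℕ) (hn : Fintype.card V = n)
    (a : n.Partition → ℚ) (ha : csf G = ∑ l : n.Partition, a l • XP l.parts)
    (b : n.Partition → ℚ)
    (hb : csf (G.deleteEdges {s(u, v)}) = ∑ l : n.Partition, b l • XP l.parts)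
    (c : (n - 1).Partition → ℚ)
    (hc : csf (contractEdge G u v) = ∑ l : (n - 1).Partition, c l • XP l.parts) :
    basisPoly n a = basisPoly n b - (Polynomial.X - 1) * basisPoly (n - 1) c := by
  have hcard : Fintype.card {w : V // w ≠ v} = n - 1 := by
    rw [Fintype.card_subtype_compl, Fintype.card_subtype_eq, hn]
  have hn0 : n - 1 + 1 = n := Nat.sub_add_cancel (hn ▸ Fintype.card_pos_iff.mpr ⟨v⟩)
  have hinj : Function.Injective fun j : ℕ => ((j : ℚ) + 2) / (j + 1) := by
    intro i j hij
    have hi : (i : ℚ) + 1 ≠ 0 := by positivity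
    have hj : (j : ℚ) + 1 ≠ 0 := by positivity
    simp only [div_eq_div_iff hi hj] at hij
    exact_mod_cast (by linarith : (i : ℚ) = j)
  refine Polynomial.eq_of_infinite_eval_eq _ _
    ((Set.infinite_range_of_injective hinj).mono ?_)
  rintro _ ⟨j, rfl⟩
  have hk : 2 ≤ j + 2 := by omega
  have hj : (j : ℚ) + 1 ≠ 0 := by positivity
  have hsub : ((j + 2 : ℕ) : ℚ) - 1 = j + 1 := by push_cast; ring
  have hA := card_properColourings_eq_eval_basisPoly G hn a ha hk
  have hB := card_properColourings_eq_eval_basisPoly _ hn b hb hk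
  have hC := card_properColourings_eq_eval_basisPoly _ hcard c hc hk
  have hdc := congrArg (Nat.cast : ℕ → ℚ) (card_properColourings_deleteEdges G huv (j + 2))
  rw [Nat.cast_add, hA, hB, hC, hsub] at hdc
  push_cast at hdc
  have hx : ((j : ℚ) + 2) / (j + 1) - 1 = 1 / (j + 1) := by field_simp; ring
  simp only [Set.mem_ofPred_eq, eval_sub, eval_mul, eval_X, eval_one, hx]
  have hpow : ((j : ℚ) + 1) ^ n = (j + 1) ^ (n - 1) * (j + 1) := by rw [← pow_succ, hn0]
  refine mul_left_cancel₀ (pow_ne_zero n hj) ?_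
  rw [mul_sub, hdc, hpow]
  field_simp
  ring
end
end
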